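/- arXiv:1210.4416 — 9 statements merged into one kernel-verified Lean document; each statement's English description precedes it below -/
import Mathlib

section
/- If P₊ is symmetric and satisfies the discrete algebraic Riccati equation, R is symmetric, and W satisfies the discrete Lyapunov equation, then −Aᵀ·(P₊·W − I) = Q·W·A₊ᵀ − (P₊·W − I)·A₊ᵀ + S·K̄₊, where I is the n×n identity matrix. -/
open Matrix

/-- −Aᵀ·(P₊·W − I) = Q·W·A₊ᵀ − (P₊·W − I)·A₊ᵀ + S·K̄₊. -/
theorem stmt_3 {n m : ℕ} (hn : 0 < n) (hm : 0 < m)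
    (A Q P W : Matrix (Fin n) (Fin n) ℝ)
    (B S : Matrix (Fin n) (Fin m) ℝ)
    (R : Matrix (Fin m) (Fin m) ℝ)
    (Λ : Matrix (Fin m) (Fin m) ℝ) (hΛ : Λ = R + Bᵀ * P * B) (hΛinv : IsUnit Λ)
    (K : Matrix (Fin m) (Fin n) ℝ) (hK : K = Λ⁻¹ * (Bᵀ * P * A + Sᵀ))
    (Ap : Matrix (Fin n) (Fin n) ℝ) (hAp : Ap = A - B * K)
    (Kb : Matrix (Fin m) (Fin n) ℝ)
    (hKb : Kb = Λ⁻¹ * (Bᵀ - Bᵀ * P * A * W * Apᵀ - Sᵀ * W * Apᵀ))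
    (hPsym : Pᵀ = P)
    (hDARE : P = Aᵀ * P * A - (Aᵀ * P * B + S) * Λ⁻¹ * (Bᵀ * P * A + Sᵀ) + Q)
    (hRsym : Rᵀ = R)
    (hW : W = Ap * W * Apᵀ + B * Λ⁻¹ * Bᵀ) :
    -(Aᵀ * (P * W - 1)) = Q * W * Apᵀ - (P * W - 1) * Apᵀ + S * Kb := by
  have hΛT : Λᵀ = Λ := by
    simp [hΛ, hRsym, hPsym, Matrix.mul_assoc]
  have hApT : Apᵀ = Aᵀ - (Aᵀ * P * B + S) * Λ⁻¹ * Bᵀ := by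
    simp [hAp, hK, hPsym, hΛT, transpose_nonsing_inv, Matrix.mul_assoc]
  have hRiccati : Q - P - S * K = -(Aᵀ * P * Ap) := by
    have hQ : Q = P - Aᵀ * P * A + (Aᵀ * P * B + S) * K := by
      rw [Matrix.mul_assoc _ Λ⁻¹, ← hK] at hDARE
      rw [eq_comm, ← sub_eq_zero] at hDARE ⊢
      rw [← neg_eq_zero, ← hDARE]
      abel
    rw [hQ, hAp]
    simp only [Matrix.add_mul, Matrix.mul_sub, Matrix.mul_assoc]
    abel
  have hKb' : Kb = Λ⁻¹ * Bᵀ - K * W * Apᵀ := by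
    rw [hKb, hK]
    simp only [Matrix.add_mul, Matrix.mul_add, Matrix.mul_sub, Matrix.mul_assoc]
    abel
  have hLyapunov : Ap * W * Apᵀ = W - B * Λ⁻¹ * Bᵀ := eq_sub_of_add_eq hW.symm
  calc -(Aᵀ * (P * W - 1))
      = -(Aᵀ * P * (W - B * Λ⁻¹ * Bᵀ)) + (Aᵀ - (Aᵀ * P * B + S) * Λ⁻¹ * Bᵀ)
          + S * Λ⁻¹ * Bᵀ := by
        simp only [Matrix.add_mul, Matrix.mul_sub, Matrix.mul_assoc, Matrix.mul_one]
        abel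
    _ = (Q - P - S * K) * W * Apᵀ + Apᵀ + S * Λ⁻¹ * Bᵀ := by
        rw [← hLyapunov, ← hApT, hRiccati]
        simp only [Matrix.neg_mul, Matrix.mul_assoc]
    _ = Q * W * Apᵀ - (P * W - 1) * Apᵀ + S * Kb := by
        rw [hKb']
        simp only [Matrix.sub_mul, Matrix.mul_sub, Matrix.mul_assoc, Matrix.one_mul]
        abel
end

section
/- If W satisfies the discrete Lyapunov equation, then −Bᵀ·(P₊·W − I) = Sᵀ·W·A₊ᵀ + R·K̄₊, where I is the n×n identity matrix. -/
open Matrix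

/-- −Bᵀ·(P₊·W − I) = Sᵀ·W·A₊ᵀ + R·K̄₊. -/
theorem stmt_4 {n m : ℕ} (hn : 0 < n) (hm : 0 < m)
    (A P W : Matrix (Fin n) (Fin n) ℝ)
    (B S : Matrix (Fin n) (Fin m) ℝ)
    (R : Matrix (Fin m) (Fin m) ℝ)
    (Λ : Matrix (Fin m) (Fin m) ℝ) (hΛ : Λ = R + Bᵀ * P * B) (hΛinv : IsUnit Λ)
    (K : Matrix (Fin m) (Fin n) ℝ) (hK : K = Λ⁻¹ * (Bᵀ * P * A + Sᵀ))
    (Ap : Matrix (Fin n) (Fin n) ℝ) (hAp : Ap = A - B * K)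
    (Kb : Matrix (Fin m) (Fin n) ℝ)
    (hKb : Kb = Λ⁻¹ * (Bᵀ - Bᵀ * P * A * W * Apᵀ - Sᵀ * W * Apᵀ))
    (hW : W = Ap * W * Apᵀ + B * Λ⁻¹ * Bᵀ) :
    -(Bᵀ * (P * W - 1)) = Sᵀ * W * Apᵀ + R * Kb := by
  have hdet : IsUnit Λ.det := (Matrix.isUnit_iff_isUnit_det Λ).mp hΛinv
  have hΛKb : Λ * Kb = Bᵀ - Bᵀ * P * A * W * Apᵀ - Sᵀ * W * Apᵀ := by
    rw [hKb, Matrix.mul_nonsing_inv_cancel_left _ _ hdet]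
  have hKb' : Kb = Λ⁻¹ * Bᵀ - K * W * Apᵀ := by
    rw [hKb, hK]
    simp only [Matrix.mul_sub, Matrix.mul_add, Matrix.add_mul, Matrix.mul_assoc]
    abel
  have hW' : W = A * W * Apᵀ + B * Kb := by
    have hApW : Ap * W * Apᵀ = A * W * Apᵀ - B * (K * W * Apᵀ) := by
      rw [← Matrix.mul_assoc B, ← Matrix.mul_assoc B, ← Matrix.sub_mul, ← Matrix.sub_mul, ← hAp]
    rw [hKb', Matrix.mul_sub, ← Matrix.mul_assoc B Λ⁻¹]
    rw [hApW] at hW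
    exact hW.trans (by abel)
  have hPW : Bᵀ * (P * W) = Bᵀ * P * A * W * Apᵀ + Bᵀ * P * B * Kb := by
    conv_lhs => rw [hW']
    simp only [Matrix.mul_add, Matrix.mul_assoc]
  have hR : R = Λ - Bᵀ * P * B := by rw [hΛ, add_sub_cancel_right]
  rw [hR, Matrix.sub_mul, hΛKb, Matrix.mul_sub, Matrix.mul_one, hPW]
  abel
end

section
/- Let v_k, w_k (0 ≤ k ≤ k_f) be sequences in ℝⁿ and define x_k = v_k + W·w_k and u_k = −K₊·v_k + K̄₊·w_{k+1}. If x_{k+1} = A·x_k + B·u_k holds for some index k with 0 ≤ k ≤ k_f − 1, and W satisfies the discrete Lyapunov equation, then v_{k+1} = A₊·v_k − A·W·A₊ᵀ·w_{k+1} + A·W·w_k. -/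
open Matrix

/-- from the state equation x_{k+1} = A x_k + B u_k one gets
    v_{k+1} = A₊ v_k − A W A₊ᵀ w_{k+1} + A W w_k. -/
theorem stmt_5 {n m : ℕ} (hn : 0 < n) (hm : 0 < m) (kf : ℕ) (hkf : 0 < kf)
    (A Q P W : Matrix (Fin n) (Fin n) ℝ)
    (B S : Matrix (Fin n) (Fin m) ℝ)
    (R : Matrix (Fin m) (Fin m) ℝ)
    (Λ : Matrix (Fin m) (Fin m) ℝ) (hΛ : Λ = R + Bᵀ * P * B) (hΛinv : IsUnit Λ)
    (K : Matrix (Fin m) (Fin n) ℝ) (hK : K = Λ⁻¹ * (Bᵀ * P * A + Sᵀ))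
    (Ap : Matrix (Fin n) (Fin n) ℝ) (hAp : Ap = A - B * K)
    (Kb : Matrix (Fin m) (Fin n) ℝ)
    (hKb : Kb = Λ⁻¹ * (Bᵀ - Bᵀ * P * A * W * Apᵀ - Sᵀ * W * Apᵀ))
    (hW : W = Ap * W * Apᵀ + B * Λ⁻¹ * Bᵀ)
    (v w : ℕ → Fin n → ℝ)
    (x : ℕ → Fin n → ℝ) (hx : ∀ k, k ≤ kf → x k = v k + W.mulVec (w k))
    (u : ℕ → Fin m → ℝ)
    (hu : ∀ k, k ≤ kf - 1 → u k = -(K.mulVec (v k)) + Kb.mulVec (w (k + 1)))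
    (k : ℕ) (hk : k ≤ kf - 1)
    (hstate : x (k + 1) = A.mulVec (x k) + B.mulVec (u k)) :
    v (k + 1) = Ap.mulVec (v k) - (A * W * Apᵀ).mulVec (w (k + 1))
      + (A * W).mulVec (w k) := by
  have hKb' : Kb = Λ⁻¹ * Bᵀ - K * W * Apᵀ := by
    rw [hKb, hK]
    simp only [Matrix.mul_sub, Matrix.mul_add, Matrix.add_mul, Matrix.mul_assoc, sub_sub]
  have hBK : B * K = A - Ap := by rw [hAp, sub_sub_cancel]
  have hLyap : B * Λ⁻¹ * Bᵀ = W - Ap * W * Apᵀ := eq_sub_of_add_eq' hW.symm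
  have hBKb : B * Kb = W - A * W * Apᵀ := by
    calc B * Kb = B * Λ⁻¹ * Bᵀ - B * K * W * Apᵀ := by
          rw [hKb', Matrix.mul_sub]
          simp only [Matrix.mul_assoc]
      _ = W - A * W * Apᵀ := by
          rw [hLyap, hBK, Matrix.sub_mul, Matrix.sub_mul]
          abel
  rw [hx (k + 1) (by omega), hx k (by omega), hu k hk] at hstate
  rw [eq_sub_of_add_eq hstate]
  simp only [mulVec_add, mulVec_neg, mulVec_mulVec, hBK, hBKb, sub_mulVec]
  abel
end

section
/- Let v_k, w_k (0 ≤ k ≤ k_f) be sequences in ℝⁿ and define x_k = v_k + W·w_k, p_k = P₊·v_k + (P₊·W − I)·w_k, and u_k = −K₊·v_k + K̄₊·w_{k+1}, where I is the n×n identity matrix. Assume P₊ is symmetric and satisfies the discrete algebraic Riccati equation, R is symmetric, and W satisfies the discrete Lyapunov equation. If −Aᵀ·p_{k+1} = Q·x_k − p_k + S·u_k holds for some index k with 0 ≤ k ≤ k_f − 1, then −Aᵀ·P₊·v_{k+1} + (Q·W − (P₊·W − I))·A₊ᵀ·w_{k+1} = −Aᵀ·P₊·A₊·v_k + (Q·W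 − (P₊·W − I))·w_k. -/
open Matrix

/-- from the costate equation −Aᵀ p_{k+1} = Q x_k − p_k + S u_k one gets
    −Aᵀ P₊ v_{k+1} + (Q W − (P₊ W − I)) A₊ᵀ w_{k+1} = −Aᵀ P₊ A₊ v_k + (Q W − (P₊ W − I)) w_k. -/
theorem stmt_6 {n m : ℕ} (hn : 0 < n) (hm : 0 < m) (kf : ℕ) (hkf : 0 < kf)
    (A Q P W : Matrix (Fin n) (Fin n) ℝ)
    (B S : Matrix (Fin n) (Fin m) ℝ)
    (R : Matrix (Fin m) (Fin m) ℝ)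
    (Λ : Matrix (Fin m) (Fin m) ℝ) (hΛ : Λ = R + Bᵀ * P * B) (hΛinv : IsUnit Λ)
    (K : Matrix (Fin m) (Fin n) ℝ) (hK : K = Λ⁻¹ * (Bᵀ * P * A + Sᵀ))
    (Ap : Matrix (Fin n) (Fin n) ℝ) (hAp : Ap = A - B * K)
    (Kb : Matrix (Fin m) (Fin n) ℝ)
    (hKb : Kb = Λ⁻¹ * (Bᵀ - Bᵀ * P * A * W * Apᵀ - Sᵀ * W * Apᵀ))
    (hPsym : Pᵀ = P)
    (hDARE : P = Aᵀ * P * A - (Aᵀ * P * B + S) * Λ⁻¹ * (Bᵀ * P * A + Sᵀ) + Q)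
    (hRsym : Rᵀ = R)
    (hW : W = Ap * W * Apᵀ + B * Λ⁻¹ * Bᵀ)
    (v w : ℕ → Fin n → ℝ)
    (x : ℕ → Fin n → ℝ) (hx : ∀ k, k ≤ kf → x k = v k + W.mulVec (w k))
    (p : ℕ → Fin n → ℝ)
    (hp : ∀ k, k ≤ kf → p k = P.mulVec (v k) + (P * W - 1).mulVec (w k))
    (u : ℕ → Fin m → ℝ)
    (hu : ∀ k, k ≤ kf - 1 → u k = -(K.mulVec (v k)) + Kb.mulVec (w (k + 1)))
    (k : ℕ) (hk : k ≤ kf - 1)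
    (hcostate : -(Aᵀ.mulVec (p (k + 1))) = Q.mulVec (x k) - p k + S.mulVec (u k)) :
    -((Aᵀ * P).mulVec (v (k + 1))) + ((Q * W - (P * W - 1)) * Apᵀ).mulVec (w (k + 1))
      = -((Aᵀ * P * Ap).mulVec (v k)) + (Q * W - (P * W - 1)).mulVec (w k) := by
  have hΛT : Λ⁻¹ᵀ = Λ⁻¹ := by
    rw [transpose_nonsing_inv, hΛ]
    simp only [transpose_add, transpose_mul, transpose_transpose, hRsym, hPsym, Matrix.mul_assoc]
  have hKT : Kᵀ = (Aᵀ * P * B + S) * Λ⁻¹ := by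
    rw [hK]
    simp only [transpose_mul, transpose_add, transpose_transpose, hPsym, hΛT, Matrix.mul_assoc]
  have hApT : Apᵀ = Aᵀ - (Aᵀ * P * B + S) * Λ⁻¹ * Bᵀ := by
    rw [hAp, transpose_sub, transpose_mul, hKT]
  have hKb' : Kb = Λ⁻¹ * Bᵀ - K * W * Apᵀ := by
    rw [hKb, hK]
    simp only [Matrix.mul_add, Matrix.add_mul, Matrix.mul_sub, Matrix.mul_assoc]
    abel
  have hQ : Q - P - S * K = -(Aᵀ * P * Ap) := by
    have hDARE' : Q - P = (Aᵀ * P * B + S) * K - Aᵀ * P * A := by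
      rw [hK, ← Matrix.mul_assoc, sub_eq_iff_eq_add]
      nth_rw 4 [hDARE]
      abel
    rw [sub_eq_iff_eq_add, hDARE', hAp]
    simp only [Matrix.add_mul, Matrix.mul_sub, Matrix.mul_assoc]
    abel
  have hW' : Ap * W * Apᵀ = W - B * Λ⁻¹ * Bᵀ := eq_sub_of_add_eq hW.symm
  have hM : (Q * W - (P * W - 1)) * Apᵀ = -(Aᵀ * (P * W - 1) + S * Kb) := by
    calc (Q * W - (P * W - 1)) * Apᵀ
        = (Q - P - S * K) * W * Apᵀ + S * K * W * Apᵀ + Apᵀ := by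
          simp only [Matrix.sub_mul, Matrix.one_mul]
          abel
      _ = -(Aᵀ * P * (Ap * W * Apᵀ)) + S * K * W * Apᵀ + Apᵀ := by
          rw [hQ]
          simp only [Matrix.neg_mul, Matrix.mul_assoc]
      _ = -(Aᵀ * P * (W - B * Λ⁻¹ * Bᵀ)) + S * K * W * Apᵀ
            + (Aᵀ - (Aᵀ * P * B + S) * Λ⁻¹ * Bᵀ) := by
          rw [hW', ← hApT]
      _ = -(Aᵀ * (P * W - 1) + S * Kb) := by
          rw [hKb']
          simp only [Matrix.mul_sub, Matrix.add_mul, Matrix.mul_assoc, Matrix.mul_one]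
          abel
  rw [hp (k + 1) (by omega), hp k (by omega), hx k (by omega), hu k hk] at hcostate
  rw [hM, ← neg_mulVec, ← neg_mulVec, ← hQ]
  simp only [mulVec_add, mulVec_neg, mulVec_mulVec] at hcostate
  simp only [add_mulVec, sub_mulVec, neg_mulVec] at hcostate ⊢
  rw [neg_add] at hcostate ⊢
  rw [← sub_eq_zero] at hcostate ⊢
  rw [← hcostate]
  abel
end

section
/- (Lemma 1, necessity direction.) Let v_k, w_k (0 ≤ k ≤ k_f) be sequences in ℝⁿ and define x_k = v_k + W·w_k, p_k = P₊·v_k + (P₊·W − I)·w_k, and u_k = −K₊·v_k + K̄₊·w_{k+1}, where I is the n×n identity matrix. Assume P₊ is symmetric and satisfies the discrete algebraic Riccati equation, R is symmetric, W satisfies the discrete Lyapunov equation, and the n×n matrix M = Q·W − (P₊·W − I) + Aᵀ·P₊·A·W is invertible. If for all k with 0 ≤ k ≤ k_f − 1 the coupled equations x_{k+1} = A·x_k + B·u_k and −Aᵀ·p_{k+1} = Q·x_k − p_k + S·u_k hold, then for all k with 0 ≤ k ≤ k_f − 1 the decoupled equations v_{k+1} = A₊·v_k and A₊ᵀ·w_{k+1}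 = w_k hold. -/
open Matrix

/-- Lemma 1, necessity: if the coupled Hamiltonian equations hold for
    the sequences defined by the correspondence, then the decoupled equations hold. -/
theorem stmt_7 {n m : ℕ} (hn : 0 < n) (hm : 0 < m) (kf : ℕ) (hkf : 0 < kf)
    (A Q P W : Matrix (Fin n) (Fin n) ℝ)
    (B S : Matrix (Fin n) (Fin m) ℝ)
    (R : Matrix (Fin m) (Fin m) ℝ)
    (Λ : Matrix (Fin m) (Fin m) ℝ) (hΛ : Λ = R + Bᵀ * P * B) (hΛinv : IsUnit Λ)
    (K : Matrix (Fin m) (Fin n) ℝ) (hK : K = Λ⁻¹ * (Bᵀ * P * A + Sᵀ))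
    (Ap : Matrix (Fin n) (Fin n) ℝ) (hAp : Ap = A - B * K)
    (Kb : Matrix (Fin m) (Fin n) ℝ)
    (hKb : Kb = Λ⁻¹ * (Bᵀ - Bᵀ * P * A * W * Apᵀ - Sᵀ * W * Apᵀ))
    (hPsym : Pᵀ = P)
    (hDARE : P = Aᵀ * P * A - (Aᵀ * P * B + S) * Λ⁻¹ * (Bᵀ * P * A + Sᵀ) + Q)
    (hRsym : Rᵀ = R)
    (hW : W = Ap * W * Apᵀ + B * Λ⁻¹ * Bᵀ)
    (M : Matrix (Fin n) (Fin n) ℝ)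
    (hM : M = Q * W - (P * W - 1) + Aᵀ * P * A * W) (hMinv : IsUnit M)
    (v w : ℕ → Fin n → ℝ)
    (x : ℕ → Fin n → ℝ) (hx : ∀ k, k ≤ kf → x k = v k + W.mulVec (w k))
    (p : ℕ → Fin n → ℝ)
    (hp : ∀ k, k ≤ kf → p k = P.mulVec (v k) + (P * W - 1).mulVec (w k))
    (u : ℕ → Fin m → ℝ)
    (hu : ∀ k, k ≤ kf - 1 → u k = -(K.mulVec (v k)) + Kb.mulVec (w (k + 1)))
    (hstate : ∀ k, k ≤ kf - 1 → x (k + 1) = A.mulVec (x k) + B.mulVec (u k))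
    (hcostate : ∀ k, k ≤ kf - 1 →
      -(Aᵀ.mulVec (p (k + 1))) = Q.mulVec (x k) - p k + S.mulVec (u k)) :
    ∀ k, k ≤ kf - 1 →
      v (k + 1) = Ap.mulVec (v k) ∧ Apᵀ.mulVec (w (k + 1)) = w k := by
  have hΛt : Λᵀ = Λ := by
    rw [hΛ]; simp [hPsym, hRsym, Matrix.mul_assoc]
  have hKt : Kᵀ = (Aᵀ * P * B + S) * Λ⁻¹ := by
    rw [hK]; simp [transpose_nonsing_inv, hΛt, hPsym, Matrix.mul_assoc]
  have hKb' : Kb = Λ⁻¹ * Bᵀ - K * W * Apᵀ := by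
    rw [hKb, hK]
    simp only [Matrix.mul_sub, Matrix.mul_add, Matrix.add_mul, Matrix.mul_assoc]
    abel
  have hBKb : B * Kb - W = -(A * W * Apᵀ) := by
    have hA : A = Ap + B * K := by rw [hAp]; abel
    have hBΛB : B * Λ⁻¹ * Bᵀ = W - Ap * W * Apᵀ := eq_sub_of_add_eq' hW.symm
    rw [hKb', Matrix.mul_sub, ← Matrix.mul_assoc B, hBΛB, hA]
    simp only [Matrix.add_mul, Matrix.mul_assoc]
    abel
  have hQ : Q = P + S * K - Aᵀ * P * Ap := by
    have hD : P = Aᵀ * P * A - (Aᵀ * P * B + S) * K + Q := by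
      rw [hK, ← Matrix.mul_assoc]; exact hDARE
    rw [← sub_eq_iff_eq_add'.mpr hD, hAp]
    simp only [Matrix.mul_sub, Matrix.add_mul, Matrix.mul_assoc]
    abel
  have hcoef : (Q * W - (P * W - 1)) * Apᵀ + S * Kb + Aᵀ * (P * W - 1) = 0 := by
    have hApt : Apᵀ = Aᵀ - (Aᵀ * P * B + S) * Λ⁻¹ * Bᵀ := by
      rw [← hKt, hAp, transpose_sub, transpose_mul]
    have hPW : Aᵀ * P * W = Aᵀ * P * Ap * W * Apᵀ + Aᵀ * P * B * Λ⁻¹ * Bᵀ := by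
      conv_lhs => rw [hW]
      simp only [Matrix.mul_add, Matrix.mul_assoc]
    have hsplit : (Q * W - (P * W - 1)) * Apᵀ + S * Kb + Aᵀ * (P * W - 1)
        = Apᵀ - Aᵀ + S * Λ⁻¹ * Bᵀ - Aᵀ * P * Ap * W * Apᵀ + Aᵀ * P * W := by
      rw [hKb', hQ]
      simp only [Matrix.mul_sub, Matrix.sub_mul, Matrix.add_mul, Matrix.mul_assoc,
        Matrix.one_mul, Matrix.mul_one]
      abel
    have hApt' : Apᵀ - Aᵀ = -((Aᵀ * P * B + S) * Λ⁻¹ * Bᵀ) := by rw [hApt]; abel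
    rw [hsplit, hPW, hApt']
    simp only [Matrix.add_mul]
    abel
  intro k hk
  have hk' : k + 1 ≤ kf := by omega
  obtain ⟨d, hd⟩ : ∃ d, w k = Apᵀ.mulVec (w (k + 1)) + d :=
    ⟨w k - Apᵀ.mulVec (w (k + 1)), by abel⟩
  have hv : v (k + 1) = Ap.mulVec (v k) + (A * W).mulVec d := by
    have h := hstate k hk
    rw [hx _ hk', hx _ (by omega), hu k hk, hd] at h
    have hB := congrArg (fun N => N.mulVec (w (k + 1))) hBKb
    simp only [Matrix.sub_mulVec, Matrix.neg_mulVec, ← Matrix.mulVec_mulVec, Matrix.mulVec_add,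
      Matrix.mulVec_neg, hAp] at h hB ⊢
    linear_combination h + hB
  have hMd : M.mulVec d = 0 := by
    have h := hcostate k hk
    rw [hp _ hk', hp _ (by omega), hx _ (by omega), hu k hk, hd, hv] at h
    have hc := congrArg (fun N => N.mulVec (w (k + 1))) hcoef
    have hq := congrArg (fun N => N.mulVec (v k)) hQ
    rw [hM]
    simp only [Matrix.sub_mulVec, Matrix.add_mulVec, ← Matrix.mulVec_mulVec, Matrix.mulVec_add,
      Matrix.mulVec_sub, Matrix.mulVec_neg, Matrix.zero_mulVec, Matrix.one_mulVec] at h hc hq ⊢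
    linear_combination -hc - h - hq
  have hd0 : d = 0 :=
    Matrix.mulVec_injective_of_isUnit hMinv (by rw [hMd, Matrix.mulVec_zero])
  subst hd0
  exact ⟨by simpa using hv, by simpa using hd.symm⟩
end

section
/- (Lemma 1, sufficiency direction.) Let v_k, w_k (0 ≤ k ≤ k_f) be sequences in ℝⁿ satisfying the decoupled equations v_{k+1} = A₊·v_k and A₊ᵀ·w_{k+1} = w_k for all k with 0 ≤ k ≤ k_f − 1. Define x_k = v_k + W·w_k, p_k = P₊·v_k + (P₊·W − I)·w_k, and u_k = −K₊·v_k + K̄₊·w_{k+1}, where I is the n×n identity matrix. Assume P₊ is symmetric and satisfies the discrete algebraic Riccati equation, R is symmetric, and W satisfies the discrete Lyapunov equation. Then for all k with 0 ≤ k ≤ k_f − 1, the coupled Hamiltonian equations hold: x_{k+1} = A·x_k + B·u_k, −Aᵀ·p_{k+1} = Q·x_k − p_k + S·u_k, and −Bᵀ·p_{k+1} = Sᵀ·x_k + R·u_k. -/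
open Matrix

/-- Transpose of the feedback gain when `P` and `Λ` are symmetric. -/
theorem transpose_gain {n m : ℕ} {A P : Matrix (Fin n) (Fin n) ℝ} {B S : Matrix (Fin n) (Fin m) ℝ}
    {Λ : Matrix (Fin m) (Fin m) ℝ} (hP : Pᵀ = P) (hΛ : Λᵀ = Λ) :
    (Λ⁻¹ * (Bᵀ * P * A + Sᵀ))ᵀ = (Aᵀ * P * B + S) * Λ⁻¹ := by
  simp [transpose_mul, transpose_nonsing_inv, hP, hΛ, Matrix.mul_assoc]

/-- Lemma 1, sufficiency: solutions of the decoupled equations yield,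
    via the correspondence, solutions of the coupled Hamiltonian equations. -/
theorem stmt_8 {n m : ℕ} (hn : 0 < n) (hm : 0 < m) (kf : ℕ) (hkf : 0 < kf)
    (A Q P W : Matrix (Fin n) (Fin n) ℝ)
    (B S : Matrix (Fin n) (Fin m) ℝ)
    (R : Matrix (Fin m) (Fin m) ℝ)
    (Λ : Matrix (Fin m) (Fin m) ℝ) (hΛ : Λ = R + Bᵀ * P * B) (hΛinv : IsUnit Λ)
    (K : Matrix (Fin m) (Fin n) ℝ) (hK : K = Λ⁻¹ * (Bᵀ * P * A + Sᵀ))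
    (Ap : Matrix (Fin n) (Fin n) ℝ) (hAp : Ap = A - B * K)
    (Kb : Matrix (Fin m) (Fin n) ℝ)
    (hKb : Kb = Λ⁻¹ * (Bᵀ - Bᵀ * P * A * W * Apᵀ - Sᵀ * W * Apᵀ))
    (hPsym : Pᵀ = P)
    (hDARE : P = Aᵀ * P * A - (Aᵀ * P * B + S) * Λ⁻¹ * (Bᵀ * P * A + Sᵀ) + Q)
    (hRsym : Rᵀ = R)
    (hW : W = Ap * W * Apᵀ + B * Λ⁻¹ * Bᵀ)
    (v w : ℕ → Fin n → ℝ)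
    (hv : ∀ k, k ≤ kf - 1 → v (k + 1) = Ap.mulVec (v k))
    (hw : ∀ k, k ≤ kf - 1 → Apᵀ.mulVec (w (k + 1)) = w k)
    (x : ℕ → Fin n → ℝ) (hx : ∀ k, k ≤ kf → x k = v k + W.mulVec (w k))
    (p : ℕ → Fin n → ℝ)
    (hp : ∀ k, k ≤ kf → p k = P.mulVec (v k) + (P * W - 1).mulVec (w k))
    (u : ℕ → Fin m → ℝ)
    (hu : ∀ k, k ≤ kf - 1 → u k = -(K.mulVec (v k)) + Kb.mulVec (w (k + 1))) :
    ∀ k, k ≤ kf - 1 →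
      x (k + 1) = A.mulVec (x k) + B.mulVec (u k) ∧
      -(Aᵀ.mulVec (p (k + 1))) = Q.mulVec (x k) - p k + S.mulVec (u k) ∧
      -(Bᵀ.mulVec (p (k + 1))) = Sᵀ.mulVec (x k) + R.mulVec (u k) := by
  intro k hk
  have hk' : k + 1 ≤ kf := by omega
  have hΛdet : IsUnit Λ.det := (Matrix.isUnit_iff_isUnit_det Λ).mp hΛinv
  have hΛsym : Λᵀ = Λ := by
    rw [hΛ]
    simp [transpose_mul, hPsym, hRsym, Matrix.mul_assoc]
  have hΛK : Λ * K = Bᵀ * P * A + Sᵀ := by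
    rw [hK, Matrix.mul_nonsing_inv_cancel_left _ _ hΛdet]
  have hKt : Kᵀ = (Aᵀ * P * B + S) * Λ⁻¹ := by
    rw [hK, transpose_gain hPsym hΛsym]
  have hKb' : Kb = Λ⁻¹ * Bᵀ - K * W * Apᵀ := by
    rw [hKb, hK]
    simp only [Matrix.mul_sub, Matrix.add_mul, Matrix.mul_add, Matrix.mul_assoc]
    abel
  have hApt : Apᵀ = Aᵀ - (Aᵀ * P * B + S) * Λ⁻¹ * Bᵀ := by
    rw [hAp, transpose_sub, transpose_mul, hKt]
  have hPA : Aᵀ * P * Ap = P - Q + S * K := by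
    have h : P = Aᵀ * P * A - (Aᵀ * P * B + S) * K + Q := by
      rw [hK, ← Matrix.mul_assoc]
      exact hDARE
    rw [sub_eq_of_eq_add h, hAp]
    simp only [Matrix.mul_sub, Matrix.add_mul, Matrix.mul_assoc]
    abel
  have hBA : Bᵀ * P * Ap = R * K - Sᵀ := by
    have h : (R + Bᵀ * P * B) * K = Bᵀ * P * A + Sᵀ := hΛ ▸ hΛK
    rw [hAp, Matrix.mul_sub, eq_sub_of_add_eq h.symm]
    simp only [Matrix.add_mul, Matrix.mul_assoc]
    abel
  have hBz : Bᵀ * P * B * Λ⁻¹ * Bᵀ = Bᵀ - R * Λ⁻¹ * Bᵀ := by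
    have h : (R + Bᵀ * P * B) * Λ⁻¹ = 1 := by
      rw [← hΛ]
      exact Matrix.mul_nonsing_inv Λ hΛdet
    rw [Matrix.add_mul] at h
    rw [eq_sub_of_add_eq' h, Matrix.sub_mul, Matrix.one_mul]
  have hAz : Aᵀ * P * B * Λ⁻¹ * Bᵀ = Aᵀ - Apᵀ - S * Λ⁻¹ * Bᵀ := by
    rw [hApt]
    simp only [Matrix.add_mul, Matrix.mul_assoc]
    abel
  have hwk := hw k hk
  have hxk := hx k (by omega)
  have hWz : W *ᵥ w (k + 1) = Ap *ᵥ W *ᵥ w k + (B * Λ⁻¹ * Bᵀ) *ᵥ w (k + 1) := by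
    conv_lhs => rw [hW]
    rw [add_mulVec, ← hwk]
    simp only [mulVec_mulVec, Matrix.mul_assoc]
  have huk : u k = (Λ⁻¹ * Bᵀ) *ᵥ w (k + 1) - K *ᵥ x k := by
    rw [hu k hk, hKb', hxk, mulVec_add, sub_mulVec, ← hwk]
    simp only [mulVec_mulVec, Matrix.mul_assoc]
    abel
  have hx1 : x (k + 1) = Ap *ᵥ x k + (B * Λ⁻¹ * Bᵀ) *ᵥ w (k + 1) := by
    rw [hx _ hk', hv k hk, hWz, hxk, mulVec_add]
    abel
  have hpk : p k = P *ᵥ x k - Apᵀ *ᵥ w (k + 1) := by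
    rw [hp k (by omega), hxk, hwk, mulVec_add, sub_mulVec, one_mulVec, mulVec_mulVec]
    abel
  have hp1 : p (k + 1) = P *ᵥ x (k + 1) - w (k + 1) := by
    rw [hp _ hk', hx _ hk', mulVec_add, sub_mulVec, one_mulVec, mulVec_mulVec]
    abel
  refine ⟨?_, ?_, ?_⟩
  · rw [hx1, huk, hAp, mulVec_sub, sub_mulVec]
    simp only [mulVec_mulVec, Matrix.mul_assoc]
    abel
  · have h : Aᵀ *ᵥ p (k + 1) = (Aᵀ * P * Ap) *ᵥ x k
        + (Aᵀ * P * B * Λ⁻¹ * Bᵀ) *ᵥ w (k + 1) - Aᵀ *ᵥ w (k + 1) := by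
      rw [hp1, hx1]
      simp only [mulVec_add, mulVec_sub, mulVec_mulVec, Matrix.mul_assoc]
    rw [h, hPA, hAz, hpk, huk]
    simp only [mulVec_sub, add_mulVec, sub_mulVec, mulVec_mulVec, Matrix.mul_assoc]
    abel
  · have h : Bᵀ *ᵥ p (k + 1) = (Bᵀ * P * Ap) *ᵥ x k
        + (Bᵀ * P * B * Λ⁻¹ * Bᵀ) *ᵥ w (k + 1) - Bᵀ *ᵥ w (k + 1) := by
      rw [hp1, hx1]
      simp only [mulVec_add, mulVec_sub, mulVec_mulVec, Matrix.mul_assoc]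
    rw [h, hBA, hBz, huk]
    simp only [mulVec_sub, sub_mulVec, mulVec_mulVec, Matrix.mul_assoc]
    abel
end

section
/- (Relation (20), sufficiency.) For every α, β ∈ ℝⁿ, define for 0 ≤ k ≤ k_f the sequences x_k = A₊ᵏ·α + W·(A₊ᵀ)^{k_f−k}·β and p_k = P₊·A₊ᵏ·α + (P₊·W − I)·(A₊ᵀ)^{k_f−k}·β, where I is the n×n identity matrix. Assume P₊ is symmetric and satisfies the discrete algebraic Riccati equation, R is symmetric, and W satisfies the discrete Lyapunov equation. Then there exists a sequence u_k ∈ ℝᵐ (0 ≤ k ≤ k_f − 1), namely u_k = −K₊·A₊ᵏ·α + K̄₊·(A₊ᵀ)^{k_f−k−1}·β, such that for all k with 0 ≤ k ≤ k_f − 1: x_{k+1} = A·x_k + B·u_k, −Aᵀ·p_{k+1} = Q·x_k − p_k + S·u_k, and −Bᵀ·p_{k+1} = Sᵀ·x_k + R·u_k. -/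
open Matrix

/-- Relation (20), sufficiency: the sequences x_k, p_k defined from
    α, β admit a control u_k (with the stated explicit formula) solving the coupled
    Hamiltonian equations. -/
theorem stmt_11 {n m : ℕ} (hn : 0 < n) (hm : 0 < m) (kf : ℕ) (hkf : 0 < kf)
    (A Q P W : Matrix (Fin n) (Fin n) ℝ)
    (B S : Matrix (Fin n) (Fin m) ℝ)
    (R : Matrix (Fin m) (Fin m) ℝ)
    (Λ : Matrix (Fin m) (Fin m) ℝ) (hΛ : Λ = R + Bᵀ * P * B) (hΛinv : IsUnit Λ)
    (K : Matrix (Fin m) (Fin n) ℝ) (hK : K = Λ⁻¹ * (Bᵀ * P * A + Sᵀ))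
    (Ap : Matrix (Fin n) (Fin n) ℝ) (hAp : Ap = A - B * K)
    (Kb : Matrix (Fin m) (Fin n) ℝ)
    (hKb : Kb = Λ⁻¹ * (Bᵀ - Bᵀ * P * A * W * Apᵀ - Sᵀ * W * Apᵀ))
    (hPsym : Pᵀ = P)
    (hDARE : P = Aᵀ * P * A - (Aᵀ * P * B + S) * Λ⁻¹ * (Bᵀ * P * A + Sᵀ) + Q)
    (hRsym : Rᵀ = R)
    (hW : W = Ap * W * Apᵀ + B * Λ⁻¹ * Bᵀ)
    (α β : Fin n → ℝ)
    (x : ℕ → Fin n → ℝ)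
    (hx : ∀ k, k ≤ kf →
      x k = (Ap ^ k).mulVec α + (W * Apᵀ ^ (kf - k)).mulVec β)
    (p : ℕ → Fin n → ℝ)
    (hp : ∀ k, k ≤ kf →
      p k = (P * Ap ^ k).mulVec α + ((P * W - 1) * Apᵀ ^ (kf - k)).mulVec β) :
    ∃ u : ℕ → Fin m → ℝ,
      (∀ k, k ≤ kf - 1 →
        u k = -((K * Ap ^ k).mulVec α) + (Kb * Apᵀ ^ (kf - k - 1)).mulVec β) ∧
      ∀ k, k ≤ kf - 1 →
        x (k + 1) = A.mulVec (x k) + B.mulVec (u k) ∧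
        -(Aᵀ.mulVec (p (k + 1))) = Q.mulVec (x k) - p k + S.mulVec (u k) ∧
        -(Bᵀ.mulVec (p (k + 1))) = Sᵀ.mulVec (x k) + R.mulVec (u k) := by
  have hdet : IsUnit Λ.det := (isUnit_iff_isUnit_det Λ).mp hΛinv
  have hΛsym : Λᵀ = Λ := by
    simp [hΛ, transpose_mul, hPsym, hRsym, Matrix.mul_assoc]
  have hΛK : Λ * K = Bᵀ * P * A + Sᵀ := by
    rw [hK, mul_nonsing_inv_cancel_left _ _ hdet]
  have hKt : Kᵀ = (Aᵀ * P * B + S) * Λ⁻¹ := by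
    simp [hK, transpose_mul, transpose_nonsing_inv, hΛsym, hPsym, Matrix.mul_assoc]
  have hApt : Apᵀ = Aᵀ - (Aᵀ * P * B + S) * Λ⁻¹ * Bᵀ := by
    rw [hAp, transpose_sub, transpose_mul, hKt]
  have hKb' : Kb = Λ⁻¹ * Bᵀ - K * (W * Apᵀ) := by
    rw [hKb, hK]
    simp only [Matrix.mul_sub, Matrix.mul_add, Matrix.add_mul, Matrix.mul_assoc]
    abel
  have hRic : Aᵀ * P * A + Q - P = (Aᵀ * P * B + S) * K := by
    rw [hK, ← Matrix.mul_assoc, sub_eq_iff_eq_add, ← sub_eq_iff_eq_add', add_sub_right_comm]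
    exact hDARE.symm
  have hRK : R * K = Bᵀ * P * A + Sᵀ - Bᵀ * P * B * K := by
    rw [← hΛK, hΛ, Matrix.add_mul, add_sub_cancel_right]
  have hWrec : W = A * (W * Apᵀ) + B * Kb := by
    conv_lhs => rw [hW]
    rw [hKb']
    nth_rw 1 [hAp]
    simp only [Matrix.mul_sub, Matrix.sub_mul, Matrix.mul_assoc]
    abel
  have hΛKb : (R + Bᵀ * P * B) * Kb = Bᵀ - (Bᵀ * P * A + Sᵀ) * (W * Apᵀ) := by
    rw [← hΛ, ← hΛK, hKb', Matrix.mul_sub, mul_nonsing_inv_cancel_left _ _ hdet,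
      Matrix.mul_assoc]
  have hcostate : (Aᵀ * P * A + Q - P) * (W * Apᵀ) + (Aᵀ * P * B + S) * Kb + Apᵀ = Aᵀ := by
    rw [hRic, hKb', hApt]
    simp only [Matrix.mul_sub, Matrix.mul_assoc]
    abel
  refine ⟨fun k => -((K * Ap ^ k).mulVec α) + (Kb * Apᵀ ^ (kf - k - 1)).mulVec β,
    fun k _ => rfl, fun k hk => ?_⟩
  have hpow : Apᵀ ^ (kf - k) = Apᵀ * Apᵀ ^ (kf - k - 1) := by
    rw [← pow_succ']
    congr 1
    omega
  rw [hx (k + 1) (by omega), hx k (by omega), hp (k + 1) (by omega), hp k (by omega), hpow,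
    pow_succ', ← Nat.sub_sub]
  simp only [← mulVec_mulVec]
  generalize (Ap ^ k).mulVec α = a
  generalize (Apᵀ ^ (kf - k - 1)).mulVec β = b
  have hApa := congrArg (·.mulVec a) hAp
  have hRica := congrArg (·.mulVec a) hRic
  have hRKa := congrArg (·.mulVec a) hRK
  have hWb := congrArg (·.mulVec b) hWrec
  have hΛKbb := congrArg (·.mulVec b) hΛKb
  have hcob := congrArg (·.mulVec b) hcostate
  simp only [add_mulVec, sub_mulVec, ← mulVec_mulVec] at hApa hRica hRKa hWb hΛKbb hcob
  simp only [mulVec_add, mulVec_neg, mulVec_sub, sub_mulVec, one_mulVec,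
    ← mulVec_mulVec]
  rw [hApa, hWb]
  simp only [mulVec_add, mulVec_sub]
  refine ⟨?_, ?_, ?_⟩
  · abel
  · linear_combination -hcob - hRica
  · linear_combination hRKa - hΛKbb
end

section
/- (Theorem 1, sufficiency.) For every α, β ∈ ℝⁿ, define for 0 ≤ k ≤ k_f the sequences x_k = A₊ᵏ·α + W·(A₊ᵀ)^{k_f−k}·β and p_k = P₊·A₊ᵏ·α + (P₊·W − I)·(A₊ᵀ)^{k_f−k}·β, and for 0 ≤ k ≤ k_f − 1 the sequence u_k = −K₊·A₊ᵏ·α + K̄₊·(A₊ᵀ)^{k_f−k−1}·β, where I is the n×n identity matrix. Assume P₊ is symmetric and satisfies the discrete algebraic Riccati equation, R is symmetric, and W satisfies the discrete Lyapunov equation. Then for all k with 0 ≤ k ≤ k_f − 1 the triple (x_k, p_k, u_k) satisfies the coupled Hamiltonian equations: x_{k+1} = A·x_k + B·u_k, −Aᵀ·p_{k+1} = Q·x_k − p_k + S·u_k, and −Bᵀ·p_{k+1} = Sᵀ·x_k + R·u_k. -/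
open Matrix

/-- Theorem 1, sufficiency: the explicit triple (x_k, p_k, u_k) built
    from α, β satisfies the coupled Hamiltonian equations on 0 ≤ k ≤ k_f − 1. -/
theorem stmt_12 {n m : ℕ} (hn : 0 < n) (hm : 0 < m) (kf : ℕ) (hkf : 0 < kf)
    (A Q P W : Matrix (Fin n) (Fin n) ℝ)
    (B S : Matrix (Fin n) (Fin m) ℝ)
    (R : Matrix (Fin m) (Fin m) ℝ)
    (Λ : Matrix (Fin m) (Fin m) ℝ) (hΛ : Λ = R + Bᵀ * P * B) (hΛinv : IsUnit Λ)
    (K : Matrix (Fin m) (Fin n) ℝ) (hK : K = Λ⁻¹ * (Bᵀ * P * A + Sᵀ))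
    (Ap : Matrix (Fin n) (Fin n) ℝ) (hAp : Ap = A - B * K)
    (Kb : Matrix (Fin m) (Fin n) ℝ)
    (hKb : Kb = Λ⁻¹ * (Bᵀ - Bᵀ * P * A * W * Apᵀ - Sᵀ * W * Apᵀ))
    (hPsym : Pᵀ = P)
    (hDARE : P = Aᵀ * P * A - (Aᵀ * P * B + S) * Λ⁻¹ * (Bᵀ * P * A + Sᵀ) + Q)
    (hRsym : Rᵀ = R)
    (hW : W = Ap * W * Apᵀ + B * Λ⁻¹ * Bᵀ)
    (α β : Fin n → ℝ)
    (x : ℕ → Fin n → ℝ)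
    (hx : ∀ k, k ≤ kf →
      x k = (Ap ^ k).mulVec α + (W * Apᵀ ^ (kf - k)).mulVec β)
    (p : ℕ → Fin n → ℝ)
    (hp : ∀ k, k ≤ kf →
      p k = (P * Ap ^ k).mulVec α + ((P * W - 1) * Apᵀ ^ (kf - k)).mulVec β)
    (u : ℕ → Fin m → ℝ)
    (hu : ∀ k, k ≤ kf - 1 →
      u k = -((K * Ap ^ k).mulVec α) + (Kb * Apᵀ ^ (kf - k - 1)).mulVec β) :
    ∀ k, k ≤ kf - 1 →
      x (k + 1) = A.mulVec (x k) + B.mulVec (u k) ∧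
      -(Aᵀ.mulVec (p (k + 1))) = Q.mulVec (x k) - p k + S.mulVec (u k) ∧
      -(Bᵀ.mulVec (p (k + 1))) = Sᵀ.mulVec (x k) + R.mulVec (u k) := by
  have hdet : IsUnit Λ.det := (Matrix.isUnit_iff_isUnit_det Λ).1 hΛinv
  have hΛsym : Λᵀ = Λ := by
    simp [hΛ, hPsym, hRsym, Matrix.mul_assoc]
  have hKT : Kᵀ = (Aᵀ * P * B + S) * Λ⁻¹ := by
    simp [hK, hPsym, hΛsym, Matrix.transpose_nonsing_inv, Matrix.mul_assoc]
  have hΛK : Λ * K = Bᵀ * P * A + Sᵀ := by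
    rw [hK, Matrix.mul_nonsing_inv_cancel_left _ _ hdet]
  have hΛKb : Λ * Kb = Bᵀ - Bᵀ * P * A * W * Apᵀ - Sᵀ * W * Apᵀ := by
    rw [hKb, Matrix.mul_nonsing_inv_cancel_left _ _ hdet]
  have hKb' : Kb = Λ⁻¹ * Bᵀ - K * W * Apᵀ := by
    rw [hKb, hK]
    simp only [Matrix.mul_sub, Matrix.mul_add, Matrix.add_mul, Matrix.mul_assoc]
    abel
  have hQ : Q = P - Aᵀ * P * Ap + S * K := by
    have h : P = Aᵀ * P * A - (Aᵀ * P * B + S) * K + Q := by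
      rw [hK, ← Matrix.mul_assoc]; exact hDARE
    rw [← sub_eq_iff_eq_add'.2 h, hAp]
    simp only [Matrix.mul_sub, Matrix.add_mul, Matrix.mul_assoc]
    abel
  have hAT : Aᵀ = Apᵀ + (Aᵀ * P * B + S) * Λ⁻¹ * Bᵀ := by
    rw [← hKT, hAp]; simp
  have hApW : Ap * W * Apᵀ = W - B * Λ⁻¹ * Bᵀ := eq_sub_of_add_eq hW.symm
  have hstate : W = A * W * Apᵀ + B * Kb := by
    have h : A * W * Apᵀ + B * Kb = Ap * W * Apᵀ + B * Λ⁻¹ * Bᵀ := by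
      have hApW' : Ap * W = A * W - B * K * W := by rw [hAp, Matrix.sub_mul]
      rw [hKb', hApW']
      simp only [Matrix.mul_sub, Matrix.sub_mul, Matrix.mul_assoc]
      abel
    exact hW.trans h.symm
  have hcostate : -(Aᵀ * (P * W - 1)) = Q * W * Apᵀ - (P * W - 1) * Apᵀ + S * Kb := by
    have h : Q * W * Apᵀ - (P * W - 1) * Apᵀ + S * Kb
        = -(Aᵀ * P * (Ap * W * Apᵀ)) + Apᵀ + S * Λ⁻¹ * Bᵀ := by
      rw [hQ, hKb']
      simp only [Matrix.mul_sub, Matrix.sub_mul, Matrix.add_mul, Matrix.mul_assoc,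
        Matrix.one_mul]
      abel
    rw [h, hApW, Matrix.mul_sub, Matrix.mul_one]
    nth_rewrite 2 [hAT]
    simp only [Matrix.mul_sub, Matrix.add_mul, Matrix.mul_assoc]
    abel
  have hR : R = Λ - Bᵀ * P * B := eq_sub_of_add_eq hΛ.symm
  have hcontrolα : -(Bᵀ * (P * Ap)) = Sᵀ - R * K := by
    rw [hR, Matrix.sub_mul, hΛK, hAp]
    simp only [Matrix.mul_sub, Matrix.mul_assoc]
    abel
  have hcontrolβ : -(Bᵀ * (P * W - 1)) = Sᵀ * W * Apᵀ + R * Kb := by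
    rw [hR, Matrix.sub_mul, hΛKb, Matrix.mul_assoc (Bᵀ * P) B Kb,
      ← sub_eq_iff_eq_add'.2 hstate]
    simp only [Matrix.mul_sub, Matrix.mul_assoc, Matrix.mul_one]
    abel
  intro k hk
  obtain ⟨j, rfl⟩ : ∃ j, kf = k + 1 + j := ⟨kf - k - 1, by omega⟩
  have hxk := hx k (by omega)
  have hxk' := hx (k + 1) (by omega)
  have hpk := hp k (by omega)
  have hpk' := hp (k + 1) (by omega)
  have huk := hu k hk
  rw [show k + 1 + j - k = j + 1 by omega] at hxk hpk huk
  rw [show k + 1 + j - (k + 1) = j by omega] at hxk' hpk'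
  rw [Nat.add_sub_cancel] at huk
  simp only [pow_succ', ← Matrix.mulVec_mulVec] at hxk hxk' hpk hpk' huk
  rw [hxk, hxk', hpk, hpk', huk]
  generalize (Ap ^ k).mulVec α = a
  generalize (Apᵀ ^ j).mulVec β = b
  refine ⟨?_, ?_, ?_⟩
  · have h := congrArg (fun M => M.mulVec b) hstate
    have h' := congrArg (fun M => M.mulVec a) hAp
    simp only [Matrix.add_mulVec, Matrix.sub_mulVec, ← Matrix.mulVec_mulVec] at h h'
    simp only [Matrix.mulVec_add, Matrix.mulVec_neg]
    linear_combination (exp := 1) h + h'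
  · have h := congrArg (fun M => M.mulVec b) hcostate
    have h' := congrArg (fun M => M.mulVec a) hQ
    simp only [Matrix.add_mulVec, Matrix.sub_mulVec, Matrix.neg_mulVec, Matrix.mulVec_sub,
      Matrix.one_mulVec, ← Matrix.mulVec_mulVec] at h h' ⊢
    simp only [Matrix.mulVec_add, Matrix.mulVec_neg, Matrix.mulVec_sub]
    linear_combination (exp := 1) h - h'
  · have h := congrArg (fun M => M.mulVec b) hcontrolβ
    have h' := congrArg (fun M => M.mulVec a) hcontrolα
    simp only [Matrix.add_mulVec, Matrix.sub_mulVec, Matrix.neg_mulVec, Matrix.mulVec_sub,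
      Matrix.one_mulVec, ← Matrix.mulVec_mulVec] at h h' ⊢
    simp only [Matrix.mulVec_add, Matrix.mulVec_neg, Matrix.mulVec_sub]
    linear_combination (exp := 1) h + h'
end

section
/- (Theorem 1, necessity via the correspondence.) Let v_k, w_k (0 ≤ k ≤ k_f) be sequences in ℝⁿ and define x_k = v_k + W·w_k, p_k = P₊·v_k + (P₊·W − I)·w_k, and u_k = −K₊·v_k + K̄₊·w_{k+1}, where I is the n×n identity matrix. Assume P₊ is symmetric and satisfies the discrete algebraic Riccati equation, R is symmetric, W satisfies the discrete Lyapunov equation, and M = Q·W − (P₊·W − I) + Aᵀ·P₊·A·W is invertible. If for all k with 0 ≤ k ≤ k_f − 1 the equations x_{k+1} = A·x_k + B·u_k and −Aᵀ·p_{k+1} = Q·x_k − p_k + S·u_k hold, then there exist α, β ∈ ℝⁿ such that for all k with 0 ≤ k ≤ k_f − 1: x_k = A₊ᵏ·α + W·A₊ᵀ·(A₊ᵀ)^{k_f−k−1}·β, p_k = P₊·A₊ᵏ·α + (P₊·W − I)·A₊ᵀ·(A₊ᵀ)^{k_f−k−1}·β, and u_k = −K₊·A₊ᵏ·α + K̄₊·(A₊ᵀ)^{k_f−k−1}·β.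 -/
open Matrix

/-- Theorem 1, necessity via the correspondence: if the coupled
    equations hold, then (x_k, p_k, u_k) has the explicit form of relation (19). -/
theorem stmt_13 {n m : ℕ} (hn : 0 < n) (hm : 0 < m) (kf : ℕ) (hkf : 0 < kf)
    (A Q P W : Matrix (Fin n) (Fin n) ℝ)
    (B S : Matrix (Fin n) (Fin m) ℝ)
    (R : Matrix (Fin m) (Fin m) ℝ)
    (Λ : Matrix (Fin m) (Fin m) ℝ) (hΛ : Λ = R + Bᵀ * P * B) (hΛinv : IsUnit Λ)
    (K : Matrix (Fin m) (Fin n) ℝ) (hK : K = Λ⁻¹ * (Bᵀ * P * A + Sᵀ))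
    (Ap : Matrix (Fin n) (Fin n) ℝ) (hAp : Ap = A - B * K)
    (Kb : Matrix (Fin m) (Fin n) ℝ)
    (hKb : Kb = Λ⁻¹ * (Bᵀ - Bᵀ * P * A * W * Apᵀ - Sᵀ * W * Apᵀ))
    (hPsym : Pᵀ = P)
    (hDARE : P = Aᵀ * P * A - (Aᵀ * P * B + S) * Λ⁻¹ * (Bᵀ * P * A + Sᵀ) + Q)
    (hRsym : Rᵀ = R)
    (hW : W = Ap * W * Apᵀ + B * Λ⁻¹ * Bᵀ)
    (M : Matrix (Fin n) (Fin n) ℝ)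
    (hM : M = Q * W - (P * W - 1) + Aᵀ * P * A * W) (hMinv : IsUnit M)
    (v w : ℕ → Fin n → ℝ)
    (x : ℕ → Fin n → ℝ) (hx : ∀ k, k ≤ kf → x k = v k + W.mulVec (w k))
    (p : ℕ → Fin n → ℝ)
    (hp : ∀ k, k ≤ kf → p k = P.mulVec (v k) + (P * W - 1).mulVec (w k))
    (u : ℕ → Fin m → ℝ)
    (hu : ∀ k, k ≤ kf - 1 → u k = -(K.mulVec (v k)) + Kb.mulVec (w (k + 1)))
    (hstate : ∀ k, k ≤ kf - 1 → x (k + 1) = A.mulVec (x k) + B.mulVec (u k))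
    (hcostate : ∀ k, k ≤ kf - 1 →
      -(Aᵀ.mulVec (p (k + 1))) = Q.mulVec (x k) - p k + S.mulVec (u k)) :
    ∃ α β : Fin n → ℝ, ∀ k, k ≤ kf - 1 →
      x k = (Ap ^ k).mulVec α + (W * Apᵀ * Apᵀ ^ (kf - k - 1)).mulVec β ∧
      p k = (P * Ap ^ k).mulVec α + ((P * W - 1) * Apᵀ * Apᵀ ^ (kf - k - 1)).mulVec β ∧
      u k = -((K * Ap ^ k).mulVec α) + (Kb * Apᵀ ^ (kf - k - 1)).mulVec β := by
  have hΛt : Λᵀ = Λ := by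
    simp [hΛ, hRsym, hPsym, Matrix.mul_assoc]
  have hApt : Apᵀ = Aᵀ - (Aᵀ * P * B + S) * Λ⁻¹ * Bᵀ := by
    rw [hAp, hK]
    simp [Matrix.transpose_nonsing_inv, hΛt, hPsym, Matrix.mul_assoc]
  have hState : A * W * Apᵀ + B * Kb = W := by
    have hB : B * Kb = B * Λ⁻¹ * Bᵀ - B * K * W * Apᵀ := by
      rw [hKb, hK]
      simp only [Matrix.mul_sub, Matrix.mul_add, Matrix.add_mul, Matrix.mul_assoc]
      abel
    have hA : A = Ap + B * K := by rw [hAp]; abel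
    calc A * W * Apᵀ + B * Kb = Ap * W * Apᵀ + B * Λ⁻¹ * Bᵀ := by
          rw [hB]; nth_rewrite 1 [hA]; simp only [Matrix.add_mul]; abel
      _ = W := hW.symm
  have hRiccati : Q + Aᵀ * P * A - P
      = (Aᵀ * P * B + S) * Λ⁻¹ * (Bᵀ * P * A + Sᵀ) := by
    nth_rewrite 2 [hDARE]; abel
  have hv : Q - P - S * K + Aᵀ * P * Ap = 0 := by
    have h : (Aᵀ * P * B + S) * K
        = (Aᵀ * P * B + S) * Λ⁻¹ * (Bᵀ * P * A + Sᵀ) := by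
      rw [hK, Matrix.mul_assoc _ Λ⁻¹]
    calc Q - P - S * K + Aᵀ * P * Ap
        = (Q + Aᵀ * P * A - P) - (Aᵀ * P * B + S) * K := by
          rw [hAp]; simp only [Matrix.mul_sub, Matrix.add_mul, Matrix.mul_assoc]; abel
      _ = 0 := by rw [hRiccati, h, sub_self]
  have hw : Q * W * Apᵀ - (P * W - 1) * Apᵀ + S * Kb + Aᵀ * (P * W - 1) = 0 := by
    have hG : (Aᵀ * P * B + S) * Kb = (Aᵀ * P * B + S) * Λ⁻¹ * Bᵀ
        - (Aᵀ * P * B + S) * Λ⁻¹ * (Bᵀ * P * A + Sᵀ) * (W * Apᵀ) := by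
      rw [hKb, Matrix.mul_assoc _ Λ⁻¹ Bᵀ, Matrix.mul_assoc _ Λ⁻¹ (_ + _),
        Matrix.mul_assoc _ (Λ⁻¹ * _), ← Matrix.mul_sub, Matrix.mul_assoc Λ⁻¹,
        ← Matrix.mul_sub]
      simp only [Matrix.add_mul, Matrix.mul_assoc, sub_sub]
    have hP : Aᵀ * (P * W) = Aᵀ * P * A * (W * Apᵀ) + Aᵀ * P * B * Kb := by
      nth_rewrite 1 [← hState]
      simp only [Matrix.mul_add, Matrix.mul_assoc]
    calc Q * W * Apᵀ - (P * W - 1) * Apᵀ + S * Kb + Aᵀ * (P * W - 1)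
        = (Q + Aᵀ * P * A - P) * (W * Apᵀ) + Apᵀ - Aᵀ + (Aᵀ * P * B + S) * Kb := by
          rw [Matrix.mul_sub, hP]
          simp only [Matrix.sub_mul, Matrix.add_mul, Matrix.mul_assoc, Matrix.one_mul,
            Matrix.mul_one]
          abel
      _ = Apᵀ - (Aᵀ - (Aᵀ * P * B + S) * Λ⁻¹ * Bᵀ) := by rw [hG, hRiccati]; abel
      _ = 0 := by rw [← hApt, sub_self]
  have hstep : ∀ k, k ≤ kf - 1 →
      v (k + 1) = Ap.mulVec (v k) ∧ w k = Apᵀ.mulVec (w (k + 1)) := by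
    intro k hk
    obtain ⟨d, hd⟩ : ∃ d, w k = Apᵀ.mulVec (w (k + 1)) + d :=
      ⟨w k - Apᵀ.mulVec (w (k + 1)), by abel⟩
    have hs := hstate k hk
    have hc := hcostate k hk
    rw [hx k (by omega), hu k hk] at hs hc
    rw [hx (k + 1) (by omega)] at hs
    rw [hp k (by omega), hp (k + 1) (by omega)] at hc
    have hv' : v (k + 1) = Ap.mulVec (v k) + (A * W).mulVec d := by
      have h : W.mulVec (w (k + 1))
          = (A * W * Apᵀ).mulVec (w (k + 1)) + (B * Kb).mulVec (w (k + 1)) := by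
        rw [← Matrix.add_mulVec, hState]
      rw [h, hd] at hs
      rw [hAp, ← sub_eq_zero]
      rw [← sub_eq_zero] at hs
      rw [← hs, hAp]
      simp only [Matrix.mulVec_add, Matrix.mulVec_neg, Matrix.sub_mulVec,
        Matrix.mulVec_mulVec, Matrix.mul_assoc]
      abel
    have hMd : M.mulVec d = 0 := by
      have h1 := congrArg (fun X => X.mulVec (v k)) hv
      have h2 := congrArg (fun X => X.mulVec (w (k + 1))) hw
      rw [hv', hd, ← sub_eq_zero] at hc
      simp only [Matrix.zero_mulVec] at h1 h2
      have key : M.mulVec d = (M.mulVec d + (Q - P - S * K + Aᵀ * P * Ap).mulVec (v k)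
          + (Q * W * Apᵀ - (P * W - 1) * Apᵀ + S * Kb
            + Aᵀ * (P * W - 1)).mulVec (w (k + 1))) := by
        rw [h1, h2]; simp
      rw [key, ← neg_eq_zero, ← hc, hM]
      simp only [Matrix.mulVec_add, Matrix.mulVec_neg, Matrix.sub_mulVec, Matrix.add_mulVec,
        Matrix.mulVec_mulVec, Matrix.mul_assoc, Matrix.mul_sub, Matrix.sub_mul,
        Matrix.one_mul, Matrix.mul_one, Matrix.one_mulVec, Matrix.mulVec_sub]
      abel
    have hd0 : d = 0 :=
      Matrix.mulVec_injective_of_isUnit hMinv (by rw [hMd, Matrix.mulVec_zero])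
    subst hd0
    exact ⟨by simpa using hv', by simpa using hd⟩
  have hvk : ∀ k, k ≤ kf → v k = (Ap ^ k).mulVec (v 0) := by
    intro k
    induction k with
    | zero => simp
    | succ k ih =>
      intro hk
      rw [(hstep k (by omega)).1, ih (by omega), Matrix.mulVec_mulVec, pow_succ']
  have hwk : ∀ j, j ≤ kf → w (kf - j) = (Apᵀ ^ j).mulVec (w kf) := by
    intro j
    induction j with
    | zero => simp
    | succ j ih =>
      intro hj
      rw [(hstep (kf - (j + 1)) (by omega)).2, show kf - (j + 1) + 1 = kf - j by omega,
        ih (by omega), Matrix.mulVec_mulVec, pow_succ']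
  refine ⟨v 0, w kf, fun k hk => ?_⟩
  have hw1 : w (k + 1) = (Apᵀ ^ (kf - k - 1)).mulVec (w kf) := by
    rw [← hwk _ (by omega)]; congr 1; omega
  rw [hx k (by omega), hp k (by omega), hu k hk, (hstep k hk).2, hw1, hvk k (by omega)]
  simp only [Matrix.mulVec_mulVec, Matrix.mul_assoc, and_self]
end
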